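/- arXiv:2509.09220 — 6 statements merged into one kernel-verified Lean document; each statement's English description precedes it below -/
import Mathlib

section
/- Let A = σ(R)⟨x_1,…,x_n⟩ be a bijective skew PBW extension of a ring R. If R is a right p.q.-Baer ring and R is (Σ,Δ)-compatible, then A is a right p.q.-Baer ring. -/
/-! Basic annihilator-condition definitions for (noncommutative) rings. -/

/-- The right annihilator `r_S(X) = {a ∈ S | Xa = 0}` of a subset `X` of a ring `S`. -/
def rAnn {S : Type*} [Ring S] (X : Set S) : Set S := {a | ∀ x ∈ X, x * a = 0}

/-- The left annihilator `ℓ_S(X) = {a ∈ S | aX = 0}` of a subset `X` of a ring `S`. -/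
def lAnn {S : Type*} [Ring S] (X : Set S) : Set S := {a | ∀ x ∈ X, a * x = 0}

/-- The principal right ideal `xS` of a ring `S`. -/
def rIdeal {S : Type*} [Ring S] (x : S) : Set S := Set.range fun s => x * s

/-- The principal left ideal `Sx` of a ring `S`. -/
def lIdeal {S : Type*} [Ring S] (x : S) : Set S := Set.range fun s => s * x

/-- A ring `S` is Baer if the right annihilator of every nonempty subset is
generated (as a right ideal) by an idempotent. -/
def IsBaerRing (S : Type*) [Ring S] : Prop :=
  ∀ X : Set S, X.Nonempty → ∃ e : S, e * e = e ∧ rAnn X = rIdeal e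

/-- A ring `S` is a right p.p.-ring if the right annihilator of every element is
generated by an idempotent. -/
def IsRightPP (S : Type*) [Ring S] : Prop :=
  ∀ a : S, ∃ e : S, e * e = e ∧ rAnn {a} = rIdeal e

/-- A ring `S` is a left p.p.-ring if the left annihilator of every element is
generated by an idempotent. -/
def IsLeftPP (S : Type*) [Ring S] : Prop :=
  ∀ a : S, ∃ e : S, e * e = e ∧ lAnn {a} = lIdeal e

/-- A ring `S` is right p.q.-Baer if the right annihilator of every principal right
ideal is generated by an idempotent. -/
def IsRightPQBaer (S : Type*) [Ring S] : Prop :=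
  ∀ a : S, ∃ e : S, e * e = e ∧ rAnn (rIdeal a) = rIdeal e

/-- A ring `S` is left p.q.-Baer if the left annihilator of every principal left
ideal is generated by an idempotent. -/
def IsLeftPQBaer (S : Type*) [Ring S] : Prop :=
  ∀ a : S, ∃ e : S, e * e = e ∧ lAnn (lIdeal a) = lIdeal e

/-- Property (a.c.) on the right: for every finitely generated right ideal
`I = a₁S + ⋯ + a_mS` there is `c` with `r_S(I) = r_S(cS)`. -/
def HasRightAC (S : Type*) [Ring S] : Prop :=
  ∀ (m : ℕ) (a : Fin m → S), ∃ c : S,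
    rAnn {y : S | ∃ s : Fin m → S, y = ∑ i, a i * s i} = rAnn (rIdeal c)

/-- Property (a.c.) on the left: for every finitely generated left ideal
`I = Sa₁ + ⋯ + Sa_m` there is `c` with `ℓ_S(I) = ℓ_S(Sc)`. -/
def HasLeftAC (S : Type*) [Ring S] : Prop :=
  ∀ (m : ℕ) (a : Fin m → S), ∃ c : S,
    lAnn {y : S | ∃ s : Fin m → S, y = ∑ i, s i * a i} = lAnn (lIdeal c)

/-- A ring is Abelian if every idempotent is central. -/
def IsAbelianRing (S : Type*) [Ring S] : Prop :=
  ∀ e : S, e * e = e → ∀ r : S, e * r = r * e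

/-- A ring `S` is NI if the set of nilpotent elements coincides with the upper
nilradical `nil*(S)`, the sum of all (two-sided) nil ideals of `S`. -/
def IsNIRing (S : Type*) [Ring S] : Prop :=
  {a : S | IsNilpotent a} =
    ((sSup {I : TwoSidedIdeal S | ∀ x ∈ I, IsNilpotent x} : TwoSidedIdeal S) : Set S)

/-- `σ^α = σ₁^{α₁} ∘ ⋯ ∘ σₙ^{αₙ}` for a family of ring endomorphisms. -/
def sigmaPow {R : Type*} [Ring R] {n : ℕ} (σ : Fin n → R →+* R) (α : Fin n → ℕ) : R → R :=
  (List.ofFn fun i => (⇑(σ i))^[α i]).foldr (· ∘ ·) id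

/-- `δ^α = δ₁^{α₁} ∘ ⋯ ∘ δₙ^{αₙ}` for a family of maps. -/
def deltaPow {R : Type*} {n : ℕ} (δ : Fin n → R → R) (α : Fin n → ℕ) : R → R :=
  (List.ofFn fun i => (δ i)^[α i]).foldr (· ∘ ·) id

/-- The ordered standard monomial `x^α = x₁^{α₁} ⋯ xₙ^{αₙ}`. -/
def monom {A : Type*} [Ring A] {n : ℕ} (x : Fin n → A) (α : Fin n → ℕ) : A :=
  (List.ofFn fun i => x i ^ α i).prod

/-- A skew PBW extension `A = σ(R)⟨x₁,…,xₙ⟩` of a ring `R`: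
`R` embeds in `A` (sharing the identity), `A` is a free left `R`-module with basis the
standard monomials, there are injective endomorphisms `σᵢ` and `σᵢ`-derivations `δᵢ`
with `xᵢ r = σᵢ(r) xᵢ + δᵢ(r)`, and `xⱼxᵢ - d_{i,j} xᵢxⱼ ∈ R + Rx₁ + ⋯ + Rxₙ`
with `d_{i,j} ≠ 0`. -/
structure SkewPBWExt (R A : Type*) [Ring R] [Ring A] (n : ℕ) where
  /-- the inclusion of `R` into `A` -/
  ι : R →+* A
  ι_inj : Function.Injective ι
  /-- the variables `x₁, …, xₙ` -/
  x : Fin n → A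
  /-- the endomorphisms `σᵢ` -/
  σ : Fin n → R →+* R
  σ_inj : ∀ i, Function.Injective (σ i)
  /-- the `σᵢ`-derivations `δᵢ` -/
  δ : Fin n → R → R
  δ_add : ∀ (i : Fin n) (a b : R), δ i (a + b) = δ i a + δ i b
  δ_leibniz : ∀ (i : Fin n) (a b : R), δ i (a * b) = σ i a * δ i b + δ i a * b
  comm_rel : ∀ (i : Fin n) (r : R), x i * ι r = ι (σ i r) * x i + ι (δ i r)
  /-- `A` is a free left `R`-module with basis the standard monomials: every element
  has a unique representation as a finite left `R`-linear combination of monomials. -/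
  basis : ∀ f : A, ∃! c : (Fin n → ℕ) →₀ R, f = c.sum fun α r => ι r * monom x α
  /-- the constants `d_{i,j}` -/
  d : Fin n → Fin n → R
  d_ne : ∀ i j, d i j ≠ 0
  quad : ∀ i j, ∃ (r0 : R) (rc : Fin n → R),
    x j * x i - ι (d i j) * (x i * x j) = ι r0 + ∑ k, ι (rc k) * x k

namespace SkewPBWExt

variable {R A : Type*} [Ring R] [Ring A] {n : ℕ}

/-- `R` is `(Σ,Δ)`-compatible. -/
def SigmaDeltaCompatible (E : SkewPBWExt R A n) : Prop :=
  ∀ (a b : R) (α : Fin n → ℕ),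
    (a * b = 0 ↔ a * sigmaPow E.σ α b = 0) ∧ (a * b = 0 → a * deltaPow E.δ α b = 0)

/-- `R` is `Σ`-rigid. -/
def SigmaRigid (E : SkewPBWExt R A n) : Prop :=
  ∀ (a : R) (α : Fin n → ℕ), a * sigmaPow E.σ α a = 0 → a = 0

/-- Condition (SA1): if `fg = 0` in `A` then all products of coefficients vanish. -/
def SA1 (E : SkewPBWExt R A n) : Prop :=
  ∀ cf cg : (Fin n → ℕ) →₀ R,
    (cf.sum fun α r => E.ι r * monom E.x α) * (cg.sum fun β r => E.ι r * monom E.x β) = 0 →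
    ∀ α β, cf α * cg β = 0

/-- The extension is bijective: every `σᵢ` is bijective and every `d_{i,j}` (`i < j`)
is invertible in `R`. -/
def Bijective (E : SkewPBWExt R A n) : Prop :=
  (∀ i, Function.Bijective (E.σ i)) ∧ ∀ i j : Fin n, i < j → IsUnit (E.d i j)

end SkewPBWExt

namespace SkewPBWExt

variable {R A : Type*} [Ring R] [Ring A] {n : ℕ}

theorem foldr_comp_single {T : Type*} (f : Fin n → T → T) (j : Fin n) :
    (List.ofFn fun i => (f i)^[(Pi.single j 1 : Fin n → ℕ) i]).foldr (· ∘ ·) id = f j := by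
  have key : ∀ l : List (Fin n), l.Nodup →
      (l.map fun i => (f i)^[(Pi.single j 1 : Fin n → ℕ) i]).foldr (· ∘ ·) id =
        if j ∈ l then f j else id := by
    intro l
    induction l with
    | nil => simp
    | cons k l ih =>
      intro h
      rw [List.nodup_cons] at h
      rw [List.map_cons, List.foldr_cons, ih h.2]
      by_cases hk : k = j
      · subst hk
        simp [h.1]
      · simp [Ne.symm hk]
  rw [List.ofFn_eq_map, key _ (List.nodup_finRange n)]
  simp

theorem SigmaDeltaCompatible.sigma {E : SkewPBWExt R A n} (h : E.SigmaDeltaCompatible)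
    (i : Fin n) (a b : R) : a * E.σ i b = 0 ↔ a * b = 0 := by
  have := (h a b (Pi.single i 1)).1
  rw [sigmaPow, foldr_comp_single (fun i => ⇑(E.σ i))] at this
  exact this.symm

theorem SigmaDeltaCompatible.delta {E : SkewPBWExt R A n} (h : E.SigmaDeltaCompatible)
    (i : Fin n) {a b : R} (hab : a * b = 0) : a * E.δ i b = 0 := by
  have := (h a b (Pi.single i 1)).2 hab
  rwa [deltaPow, foldr_comp_single] at this

theorem SigmaDeltaCompatible.sigma_idem {E : SkewPBWExt R A n} (h : E.SigmaDeltaCompatible)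
    (i : Fin n) {e : R} (he : e * e = e) : E.σ i e = e := by
  have h1 := (h.sigma i (1 - e) e).2 (by rw [sub_mul, one_mul, he, sub_self])
  have h2 := (h.sigma i e (1 - e)).2 (by rw [mul_sub, mul_one, he, sub_self])
  rw [sub_mul, one_mul, sub_eq_zero] at h1
  rw [map_sub, map_one, mul_sub, mul_one, sub_eq_zero] at h2
  rw [h1, ← h2]

theorem delta_one (E : SkewPBWExt R A n) (i : Fin n) : E.δ i 1 = 0 := by
  have := E.δ_leibniz i 1 1
  simpa using this

theorem SigmaDeltaCompatible.delta_idem {E : SkewPBWExt R A n} (h : E.SigmaDeltaCompatible)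
    (i : Fin n) {e : R} (he : e * e = e) : E.δ i e = 0 := by
  have h1 := h.delta i (a := 1 - e) (b := e) (by rw [sub_mul, one_mul, he, sub_self])
  have h2 := h.delta i (a := e) (b := 1 - e) (by rw [mul_sub, mul_one, he, sub_self])
  have h3 : E.δ i (1 - e) = - E.δ i e := by
    have := E.δ_add i (1 - e) e
    rw [sub_add_cancel, delta_one] at this
    exact eq_neg_of_add_eq_zero_left this.symm
  rw [h3, mul_neg, neg_eq_zero] at h2
  rwa [sub_mul, one_mul, h2, sub_zero] at h1

theorem commute_monom (E : SkewPBWExt R A n) {a : A} (ha : ∀ i, Commute a (E.x i))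
    (α : Fin n → ℕ) : Commute a (monom E.x α) := by
  refine Commute.list_prod_right _ _ fun y hy => ?_
  obtain ⟨i, rfl⟩ := List.mem_ofFn.1 hy
  exact (ha i).pow_right _

theorem SigmaDeltaCompatible.commute_idem_monom {E : SkewPBWExt R A n}
    (h : E.SigmaDeltaCompatible) {e : R} (he : e * e = e) (α : Fin n → ℕ) :
    Commute (E.ι e) (monom E.x α) := by
  refine E.commute_monom (fun i => ?_) α
  have := E.comm_rel i e
  rw [h.sigma_idem i he, h.delta_idem i he, map_zero, add_zero] at this
  exact this.symm

/-- The element of `A` with a given family of coefficients. -/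
noncomputable def ofCoeff (E : SkewPBWExt R A n) : ((Fin n → ℕ) →₀ R) →+ A :=
  Finsupp.liftAddHom fun α => (AddMonoidHom.mulRight (monom E.x α)).comp E.ι.toAddMonoidHom

theorem ofCoeff_apply (E : SkewPBWExt R A n) (c : (Fin n → ℕ) →₀ R) :
    E.ofCoeff c = c.sum fun α r => E.ι r * monom E.x α := rfl

theorem ofCoeff_single (E : SkewPBWExt R A n) (α : Fin n → ℕ) (r : R) :
    E.ofCoeff (Finsupp.single α r) = E.ι r * monom E.x α := by
  rw [ofCoeff_apply, Finsupp.sum_single_index]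
  simp

theorem ofCoeff_bijective (E : SkewPBWExt R A n) : Function.Bijective E.ofCoeff := by
  refine (Function.bijective_iff_existsUnique _).2 fun f => ?_
  obtain ⟨c, hc, hu⟩ := E.basis f
  exact ⟨c, hc.symm, fun c' h => hu c' h.symm⟩

/-- The coefficients of an element of `A` in the basis of standard monomials. -/
noncomputable def coeff (E : SkewPBWExt R A n) : A ≃+ ((Fin n → ℕ) →₀ R) :=
  (AddEquiv.ofBijective E.ofCoeff E.ofCoeff_bijective).symm

theorem coeff_term (E : SkewPBWExt R A n) (α : Fin n → ℕ) (r : R) :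
    E.coeff (E.ι r * monom E.x α) = Finsupp.single α r := by
  rw [← ofCoeff_single]
  exact (AddEquiv.ofBijective E.ofCoeff E.ofCoeff_bijective).symm_apply_apply _

theorem sum_coeff (E : SkewPBWExt R A n) (f : A) :
    ∑ α ∈ (E.coeff f).support, E.ι (E.coeff f α) * monom E.x α = f :=
  (AddEquiv.ofBijective E.ofCoeff E.ofCoeff_bijective).apply_symm_apply f

/-- The additive subgroup of elements of total degree less than `m`. -/
def degLT (E : SkewPBWExt R A n) (m : ℕ) : AddSubgroup A :=
  AddSubgroup.closure {a | ∃ (r : R) (γ : Fin n → ℕ), ∑ i, γ i < m ∧ a = E.ι r * monom E.x γ}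

theorem term_mem_degLT (E : SkewPBWExt R A n) (r : R) {γ : Fin n → ℕ} {m : ℕ}
    (h : ∑ i, γ i < m) : E.ι r * monom E.x γ ∈ E.degLT m :=
  AddSubgroup.subset_closure ⟨r, γ, h, rfl⟩

theorem degLT_mono (E : SkewPBWExt R A n) {m k : ℕ} (h : m ≤ k) : E.degLT m ≤ E.degLT k := by
  refine AddSubgroup.closure_mono ?_
  rintro _ ⟨r, γ, hγ, rfl⟩
  exact ⟨r, γ, hγ.trans_le h, rfl⟩

theorem mul_mem_of_degLT (E : SkewPBWExt R A n) {m : ℕ} {a : A} {S : AddSubgroup A}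
    (h : ∀ (r : R) (γ : Fin n → ℕ), ∑ i, γ i < m → a * (E.ι r * monom E.x γ) ∈ S)
    {b : A} (hb : b ∈ E.degLT m) : a * b ∈ S := by
  have : E.degLT m ≤ S.comap (AddMonoidHom.mulLeft a) := by
    refine (AddSubgroup.closure_le _).2 ?_
    rintro _ ⟨r, γ, hγ, rfl⟩
    exact h r γ hγ
  exact this hb

theorem ι_mul_mem_degLT (E : SkewPBWExt R A n) (r : R) {m : ℕ} {b : A} (hb : b ∈ E.degLT m) :
    E.ι r * b ∈ E.degLT m := by
  refine E.mul_mem_of_degLT (fun s γ hγ => ?_) hb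
  rw [← mul_assoc, ← map_mul]
  exact E.term_mem_degLT _ hγ

theorem coeff_eq_zero_of_mem_degLT (E : SkewPBWExt R A n) {m : ℕ} {a : A} (ha : a ∈ E.degLT m)
    {γ : Fin n → ℕ} (hγ : m ≤ ∑ i, γ i) : E.coeff a γ = 0 := by
  have : E.degLT m ≤
      ((Finsupp.applyAddHom γ).comp E.coeff.toAddMonoidHom : A →+ R).ker := by
    refine (AddSubgroup.closure_le _).2 ?_
    rintro _ ⟨r, β, hβ, rfl⟩
    have hne : β ≠ γ := by
      rintro rfl
      omega
    change E.coeff (E.ι r * monom E.x β) γ = 0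
    rw [coeff_term, Finsupp.single_eq_of_ne hne.symm]
  exact this ha

theorem x_mul_monom_of_le (x : Fin n → A) (j : Fin n) (β : Fin n → ℕ)
    (hβ : ∀ k < j, β k = 0) : x j * monom x β = monom x (β + Pi.single j 1) := by
  have key : ∀ l : List (Fin n), l.Pairwise (· < ·) → j ∈ l →
      x j * (l.map fun i => x i ^ β i).prod =
        (l.map fun i => x i ^ (β + Pi.single j 1 : Fin n → ℕ) i).prod := by
    intro l
    induction l with
    | nil => simp
    | cons k l ih =>
      intro hl hj
      rw [List.pairwise_cons] at hl
      rw [List.map_cons, List.map_cons, List.prod_cons, List.prod_cons]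
      by_cases hk : k = j
      · subst hk
        have : (l.map fun i => x i ^ (β + Pi.single k 1 : Fin n → ℕ) i) = l.map fun i => x i ^ β i := by
          refine List.map_congr_left fun i hi => ?_
          simp [Pi.single_eq_of_ne (hl.1 i hi).ne']
        rw [this, ← mul_assoc, ← pow_succ']
        simp
      · have hjl : j ∈ l := (List.mem_cons.1 hj).resolve_left (Ne.symm hk)
        rw [Pi.add_apply, Pi.single_eq_of_ne hk, hβ k (hl.1 j hjl), ← ih hl.2 hjl]
        simp
  rw [monom, monom, List.ofFn_eq_map, List.ofFn_eq_map]
  exact key _ (List.pairwise_lt_finRange n) (List.mem_finRange j)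

theorem sum_add_single (β : Fin n → ℕ) (j : Fin n) :
    ∑ i, (β + Pi.single j 1 : Fin n → ℕ) i = ∑ i, β i + 1 := by
  simp [Finset.sum_add_distrib]

/-- If `xᵢ` multiplies every monomial of degree less than `m` into degree at most one more,
then it raises degrees below `m` by at most one. -/
theorem x_mul_mem_degLT_of (E : SkewPBWExt R A n) {m : ℕ} {i : Fin n}
    (h : ∀ γ : Fin n → ℕ, ∑ k, γ k < m → E.x i * monom E.x γ ∈ E.degLT (m + 1))
    {b : A} (hb : b ∈ E.degLT m) : E.x i * b ∈ E.degLT (m + 1) := by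
  refine E.mul_mem_of_degLT (fun r γ hγ => ?_) hb
  rw [← mul_assoc, E.comm_rel, add_mul, mul_assoc]
  exact add_mem (E.ι_mul_mem_degLT _ (h γ hγ)) (E.term_mem_degLT _ (hγ.trans m.lt_succ_self))

theorem Bijective.exists_x_mul_monom {E : SkewPBWExt R A n} (hE : E.Bijective) (i : Fin n)
    (α : Fin n → ℕ) : ∃ u : R, IsUnit u ∧
      E.x i * monom E.x α - E.ι u * monom E.x (α + Pi.single i 1) ∈
        E.degLT (∑ k, α k + 1) := by
  induction hm : ∑ k, α k using Nat.strong_induction_on generalizing i α with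
  | _ m ih =>
  by_cases hi : ∀ k < i, α k = 0
  · exact ⟨1, isUnit_one, by simp [x_mul_monom_of_le E.x i α hi]⟩
  have hx : ∀ (k : Fin n) (p : ℕ), p ≤ m → ∀ b ∈ E.degLT p, E.x k * b ∈ E.degLT (p + 1) := by
    intro k p hp b hb
    refine E.x_mul_mem_degLT_of (fun γ hγ => ?_) hb
    obtain ⟨u, -, hu⟩ := ih _ (hγ.trans_le hp) k γ rfl
    have h2 : E.ι u * monom E.x (γ + Pi.single k 1) ∈ E.degLT (p + 1) :=
      E.term_mem_degLT u (by rw [sum_add_single]; omega)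
    have := add_mem (E.degLT_mono (by omega) hu) h2
    rwa [sub_add_cancel] at this
  have hne : ∃ k, α k ≠ 0 := by
    push Not at hi
    exact hi.imp fun k hk => hk.2
  obtain ⟨j, hj, hmin⟩ : ∃ j, α j ≠ 0 ∧ ∀ k < j, α k = 0 := by
    classical
    refine ⟨Fin.find _ hne, Fin.find_spec hne, fun k hk => ?_⟩
    by_contra h
    exact Fin.find_min hne hk h
  have hji : j < i := by
    by_contra h
    exact hi fun k hk => hmin k (hk.trans_le (not_lt.1 h))
  obtain ⟨β, rfl⟩ : ∃ β, α = β + Pi.single j 1 :=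
    ⟨α - Pi.single j 1, (tsub_add_cancel_of_le (by
      intro k
      by_cases hk : k = j
      · subst hk
        simpa using Nat.one_le_iff_ne_zero.2 hj
      · simp [Pi.single_eq_of_ne hk])).symm⟩
  rw [sum_add_single] at hm
  have hβ : ∀ k < j, β k = 0 := fun k hk => by
    have := hmin k hk
    simpa [Pi.single_eq_of_ne hk.ne] using this
  obtain ⟨u, hu, hl⟩ := ih (∑ k, β k) (by omega) i β rfl
  obtain ⟨r0, rc, hq⟩ := E.quad j i
  refine ⟨E.d j i * E.σ j u, (hE.2 j i hji).mul (hu.map (E.σ j)), ?_⟩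
  have hxj : E.x j * monom E.x (β + Pi.single i 1) =
      monom E.x (β + Pi.single j 1 + Pi.single i 1) := by
    rw [x_mul_monom_of_le E.x j, add_right_comm]
    intro k hk
    simp [hβ k hk, Pi.single_eq_of_ne (hk.trans hji).ne]
  set l := E.x i * monom E.x β - E.ι u * monom E.x (β + Pi.single i 1) with hldef
  have hil : E.x i * monom E.x β = l + E.ι u * monom E.x (β + Pi.single i 1) := by
    rw [hldef, sub_add_cancel]
  have hexp : E.x i * monom E.x (β + Pi.single j 1) -
      E.ι (E.d j i * E.σ j u) * monom E.x (β + Pi.single j 1 + Pi.single i 1) =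
      E.ι (E.d j i) * (E.x j * l) +
      E.ι (E.d j i * E.δ j u) * monom E.x (β + Pi.single i 1) +
      E.ι r0 * monom E.x β + ∑ k, E.ι (rc k) * (E.x k * monom E.x β) := by
    rw [← x_mul_monom_of_le E.x j β hβ, ← mul_assoc, eq_add_of_sub_eq hq, ← hxj]
    have h1 : E.ι (E.d j i) * (E.x j * E.x i) * monom E.x β =
        E.ι (E.d j i) * (E.x j * l) +
          E.ι (E.d j i) * ((E.x j * E.ι u) * monom E.x (β + Pi.single i 1)) := by
      rw [mul_assoc, mul_assoc, hil, mul_add, mul_add, mul_assoc (E.x j)]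
    rw [add_mul, add_mul, h1, E.comm_rel, Finset.sum_mul, map_mul, map_mul]
    simp only [mul_assoc, mul_add, add_mul]
    abel
  rw [hexp]
  have hβm : ∑ k, β k < m := by omega
  refine add_mem (add_mem (add_mem ?_ ?_) ?_) (sum_mem fun k _ => ?_)
  · exact E.ι_mul_mem_degLT _ (hx j m le_rfl l (E.degLT_mono (by omega) hl))
  · exact E.term_mem_degLT _ (by rw [sum_add_single]; omega)
  · exact E.term_mem_degLT _ (by omega)
  · refine E.ι_mul_mem_degLT _ (hx k m le_rfl _ ?_)
    simpa using E.term_mem_degLT 1 hβm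

theorem Bijective.x_mul_mem_degLT {E : SkewPBWExt R A n} (hE : E.Bijective) (i : Fin n) {m : ℕ}
    {b : A} (hb : b ∈ E.degLT m) : E.x i * b ∈ E.degLT (m + 1) := by
  refine E.x_mul_mem_degLT_of (fun γ hγ => ?_) hb
  obtain ⟨u, -, hu⟩ := hE.exists_x_mul_monom i γ
  have h2 : E.ι u * monom E.x (γ + Pi.single i 1) ∈ E.degLT (m + 1) :=
    E.term_mem_degLT u (by rw [sum_add_single]; omega)
  have := add_mem (E.degLT_mono (by omega) hu) h2
  rwa [sub_add_cancel] at this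

/-- Modulo lower degree, `y` is a multiple of the monomial `γ` whose coefficient has the same
left annihilator as `t`. -/
def HasLead (E : SkewPBWExt R A n) (t : R) (γ : Fin n → ℕ) (y : A) : Prop :=
  ∃ s : R, y - E.ι s * monom E.x γ ∈ E.degLT (∑ i, γ i) ∧ ∀ a : R, a * s = 0 ↔ a * t = 0

theorem hasLead_term (E : SkewPBWExt R A n) (t : R) (γ : Fin n → ℕ) :
    E.HasLead t γ (E.ι t * monom E.x γ) :=
  ⟨t, by simp, fun _ => Iff.rfl⟩

theorem HasLead.x_mul {E : SkewPBWExt R A n} (hE : E.Bijective) (hc : E.SigmaDeltaCompatible)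
    {t : R} {γ : Fin n → ℕ} {y : A} (h : E.HasLead t γ y) (i : Fin n) :
    E.HasLead t (γ + Pi.single i 1) (E.x i * y) := by
  obtain ⟨s, hs, hst⟩ := h
  obtain ⟨u, hu, hl⟩ := hE.exists_x_mul_monom i γ
  refine ⟨E.σ i s * u, ?_, fun a => ?_⟩
  · rw [sum_add_single]
    have hexp : E.x i * y - E.ι (E.σ i s * u) * monom E.x (γ + Pi.single i 1) =
        E.x i * (y - E.ι s * monom E.x γ) +
        E.ι (E.σ i s) *
          (E.x i * monom E.x γ - E.ι u * monom E.x (γ + Pi.single i 1)) +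
        E.ι (E.δ i s) * monom E.x γ := by
      rw [mul_sub, ← mul_assoc (E.x i) (E.ι s), E.comm_rel, map_mul]
      simp only [mul_assoc, mul_sub, add_mul]
      abel
    rw [hexp]
    exact add_mem (add_mem (hE.x_mul_mem_degLT i hs) (E.ι_mul_mem_degLT _ hl))
      (E.term_mem_degLT _ (Nat.lt_succ_self _))
  · rw [← mul_assoc, hu.mul_left_eq_zero, hc.sigma, hst]

theorem HasLead.pow_mul {E : SkewPBWExt R A n} (hE : E.Bijective) (hc : E.SigmaDeltaCompatible)
    {t : R} {γ : Fin n → ℕ} {y : A} (h : E.HasLead t γ y) (i : Fin n) (k : ℕ) :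
    E.HasLead t (γ + Pi.single i k) (E.x i ^ k * y) := by
  induction k with
  | zero => simpa using h
  | succ k ih =>
    have := ih.x_mul hE hc i
    rwa [← mul_assoc, ← pow_succ', add_assoc, ← Pi.single_add] at this

theorem HasLead.monom_mul {E : SkewPBWExt R A n} (hE : E.Bijective)
    (hc : E.SigmaDeltaCompatible) {t : R} {γ : Fin n → ℕ} {y : A} (h : E.HasLead t γ y)
    (α : Fin n → ℕ) : E.HasLead t (α + γ) (monom E.x α * y) := by
  have key : ∀ l : List (Fin n),
      E.HasLead t (γ + (l.map fun i => Pi.single i (α i)).sum)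
        ((l.map fun i => E.x i ^ α i).prod * y) := by
    intro l
    induction l with
    | nil => simpa using h
    | cons k l ih =>
      have := ih.pow_mul hE hc k (α k)
      rwa [← mul_assoc, add_assoc, add_comm (List.sum _)] at this
  have := key (List.finRange n)
  have hsum : ((List.finRange n).map fun i => (Pi.single i (α i) : Fin n → ℕ)).sum = α := by
    rw [← List.ofFn_eq_map, List.sum_ofFn]
    exact Finset.univ_sum_single α
  rwa [hsum, add_comm, ← List.ofFn_eq_map] at this

/-- The degree-lexicographic position of an exponent. -/
def degLexKey (α : Fin n → ℕ) : ℕ ×ₗ Lex (Fin n → ℕ) := toLex (∑ i, α i, toLex α)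

theorem degLexKey_add (α β : Fin n → ℕ) :
    degLexKey (α + β) = degLexKey α + degLexKey β := by
  simp only [degLexKey, Pi.add_apply, Finset.sum_add_distrib]
  rfl

theorem degLexKey_injective : Function.Injective (degLexKey (n := n)) :=
  fun _ _ h => congrArg (fun p : ℕ ×ₗ Lex (Fin n → ℕ) => ofLex (ofLex p).2) h

theorem sum_le_of_degLexKey_le {α β : Fin n → ℕ} (h : degLexKey α ≤ degLexKey β) :
    ∑ i, α i ≤ ∑ i, β i := by
  rcases Prod.Lex.toLex_le_toLex.1 h with h | h
  · exact h.le
  · exact h.1.le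

theorem eq_of_degLexKey_le_of_add_eq {α β α' β' : Fin n → ℕ} (hα : degLexKey α' ≤ degLexKey α)
    (hβ : degLexKey β' ≤ degLexKey β) (h : α' + β' = α + β) : α' = α ∧ β' = β := by
  have hk : degLexKey α' + degLexKey β' = degLexKey α + degLexKey β := by
    rw [← degLexKey_add, ← degLexKey_add, h]
  obtain ⟨h1, h2⟩ := (add_eq_add_iff_eq_and_eq hα hβ).1 hk
  exact ⟨degLexKey_injective h1, degLexKey_injective h2⟩

/-- `α` is the degree-lexicographically leading exponent of `f`. -/
def IsLeading (E : SkewPBWExt R A n) (f : A) (α : Fin n → ℕ) : Prop :=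
  α ∈ (E.coeff f).support ∧ ∀ α' ∈ (E.coeff f).support, degLexKey α' ≤ degLexKey α

theorem exists_isLeading (E : SkewPBWExt R A n) {f : A} (hf : f ≠ 0) :
    ∃ α, E.IsLeading f α := by
  refine Finset.exists_max_image _ degLexKey (Finsupp.support_nonempty_iff.2 ?_)
  rwa [Ne, EmbeddingLike.map_eq_zero_iff]

theorem coeff_term_mul_term {E : SkewPBWExt R A n} (hE : E.Bijective)
    (hc : E.SigmaDeltaCompatible) (t : R) (α β : Fin n → ℕ) :
    ∃ s : R, (∀ a, a * s = 0 ↔ a * t = 0) ∧ ∀ (a : R) (γ : Fin n → ℕ),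
      ∑ i, (α + β) i ≤ ∑ i, γ i →
      E.coeff (E.ι a * monom E.x α * (E.ι t * monom E.x β)) γ =
        Finsupp.single (α + β) (a * s) γ := by
  obtain ⟨s, hs, hst⟩ := (E.hasLead_term t β).monom_mul hE hc α
  refine ⟨s, hst, fun a γ hγ => ?_⟩
  have h0 := E.coeff_eq_zero_of_mem_degLT (E.ι_mul_mem_degLT a hs) hγ
  rw [mul_sub, ← mul_assoc, ← mul_assoc (E.ι a) (E.ι s), ← map_mul, map_sub, coeff_term,
    Finsupp.sub_apply, sub_eq_zero] at h0
  exact h0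

theorem IsLeading.mul_eq_zero {E : SkewPBWExt R A n} (hE : E.Bijective)
    (hc : E.SigmaDeltaCompatible) {f g : A} {α β : Fin n → ℕ} (hα : E.IsLeading f α)
    (hβ : E.IsLeading g β) (r : R) (h : f * E.ι r * g = 0) :
    E.coeff f α * r * E.coeff g β = 0 := by
  have hexp : ∑ α' ∈ (E.coeff f).support, ∑ β' ∈ (E.coeff g).support,
      E.ι (E.coeff f α') * monom E.x α' * (E.ι (r * E.coeff g β') * monom E.x β') = 0 := by
    rw [← h]
    conv_rhs => rw [← E.sum_coeff f, ← E.sum_coeff g, mul_assoc, Finset.mul_sum]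
    simp only [Finset.sum_mul, Finset.mul_sum, map_mul, mul_assoc]
    exact Finset.sum_comm
  have hterm : ∀ α' ∈ (E.coeff f).support, ∀ β' ∈ (E.coeff g).support, (α', β') ≠ (α, β) →
      E.coeff (E.ι (E.coeff f α') * monom E.x α' *
        (E.ι (r * E.coeff g β') * monom E.x β')) (α + β) = 0 := by
    intro α' hα' β' hβ' hne
    obtain ⟨s, -, hs⟩ := coeff_term_mul_term hE hc (r * E.coeff g β') α' β'
    rw [hs _ _ ?_, Finsupp.single_eq_of_ne]
    · intro he
      obtain ⟨rfl, rfl⟩ := eq_of_degLexKey_le_of_add_eq (hα.2 _ hα') (hβ.2 _ hβ') he.symm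
      exact hne rfl
    · refine sum_le_of_degLexKey_le ?_
      rw [degLexKey_add, degLexKey_add]
      exact add_le_add (hα.2 _ hα') (hβ.2 _ hβ')
  have hcoeff := DFunLike.congr_fun (congrArg E.coeff hexp) (α + β)
  rw [← Finset.sum_product', map_sum, Finsupp.finsetSum_apply, map_zero, Finsupp.zero_apply,
    Finset.sum_eq_single_of_mem (α, β) (Finset.mk_mem_product hα.1 hβ.1)
      fun p hp hne => hterm p.1 (Finset.mem_product.1 hp).1 p.2 (Finset.mem_product.1 hp).2 hne]
    at hcoeff
  obtain ⟨s, hst, hs⟩ := coeff_term_mul_term hE hc (r * E.coeff g β) α β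
  rw [hs _ _ le_rfl, Finsupp.single_eq_same, hst, ← mul_assoc] at hcoeff
  exact hcoeff

theorem SigmaDeltaCompatible.coeff_mul_idem {E : SkewPBWExt R A n} (hc : E.SigmaDeltaCompatible)
    {e : R} (he : e * e = e) (f : A) (α : Fin n → ℕ) :
    E.coeff (f * E.ι e) α = E.coeff f α * e := by
  conv_lhs => rw [← E.sum_coeff f]
  rw [Finset.sum_mul, map_sum, Finsupp.finsetSum_apply]
  have : ∀ β ∈ (E.coeff f).support,
      E.coeff (E.ι (E.coeff f β) * monom E.x β * E.ι e) α =
        if β = α then E.coeff f β * e else 0 := by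
    intro β _
    rw [mul_assoc, ← (hc.commute_idem_monom he β).eq, ← mul_assoc, ← map_mul, coeff_term,
      Finsupp.single_apply]
  rw [Finset.sum_congr rfl this, Finset.sum_ite_eq']
  split_ifs with h
  · rfl
  · rw [Finsupp.notMem_support_iff.1 h, zero_mul]

theorem SigmaDeltaCompatible.semicentral {E : SkewPBWExt R A n} (hc : E.SigmaDeltaCompatible)
    {e : R} (he : e * e = e) (hs : ∀ r, r * e = e * r * e) (f : A) :
    f * E.ι e = E.ι e * f * E.ι e := by
  rw [← E.sum_coeff f, Finset.mul_sum, Finset.sum_mul, Finset.sum_mul]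
  refine Finset.sum_congr rfl fun α _ => ?_
  rw [← mul_assoc, mul_assoc, ← (hc.commute_idem_monom he α).eq, mul_assoc (_ * _),
    ← (hc.commute_idem_monom he α).eq, ← mul_assoc, ← mul_assoc, ← map_mul, ← map_mul,
    ← map_mul, ← hs]

theorem exists_idem_of_leading {E : SkewPBWExt R A n} (hE : E.Bijective)
    (hpq : IsRightPQBaer R) (hc : E.SigmaDeltaCompatible) (f : A) :
    ∃ e : R, e * e = e ∧ (∀ r, r * e = e * r * e) ∧ f * E.ι e = 0 ∧
      ∀ g β, (∀ s, f * s * g = 0) → E.IsLeading g β → e * E.coeff g β = E.coeff g β := by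
  induction hm : (E.coeff f).support.card using Nat.strong_induction_on generalizing f with
  | _ m ih =>
  by_cases hf : f = 0
  · exact ⟨1, by simp, by simp, by simp [hf], by simp⟩
  obtain ⟨α, hα⟩ := E.exists_isLeading hf
  obtain ⟨e₁, he₁, hann⟩ := hpq (E.coeff f α)
  have hmem : ∀ b, (∀ r, E.coeff f α * r * b = 0) ↔ ∃ s, e₁ * s = b := by
    intro b
    have := Set.ext_iff.1 hann b
    simpa [rAnn, rIdeal] using this
  have hfix : ∀ b, (∀ r, E.coeff f α * r * b = 0) → e₁ * b = b := by
    intro b hb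
    obtain ⟨s, rfl⟩ := (hmem b).1 hb
    rw [← mul_assoc, he₁]
  have hann₁ : ∀ r, E.coeff f α * r * e₁ = 0 := (hmem e₁).2 ⟨1, mul_one _⟩
  have hs₁ : ∀ r, r * e₁ = e₁ * r * e₁ := by
    intro r
    rw [mul_assoc, hfix (r * e₁)]
    intro r'
    rw [← mul_assoc, mul_assoc _ r']
    exact hann₁ _
  have hlt : (E.coeff (f * E.ι e₁)).support.card < m := by
    rw [← hm]
    refine Finset.card_lt_card (Finset.ssubset_iff_subset_ne.2 ⟨fun β hβ => ?_, fun h => ?_⟩)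
    · rw [Finsupp.mem_support_iff, hc.coeff_mul_idem he₁] at hβ
      exact Finsupp.mem_support_iff.2 (left_ne_zero_of_mul hβ)
    · have := hα.1
      rw [← h, Finsupp.mem_support_iff, hc.coeff_mul_idem he₁] at this
      exact this (by simpa using hann₁ 1)
  obtain ⟨e₂, he₂, hs₂, hfe₂, hlead⟩ := ih _ hlt (f * E.ι e₁) rfl
  refine ⟨e₁ * e₂, ?_, fun r => ?_, ?_, fun g β hg hβ => ?_⟩
  · rw [mul_assoc, ← mul_assoc e₂, ← hs₂, ← mul_assoc, he₁]
  · calc r * (e₁ * e₂) = e₁ * (r * e₁ * e₂) := by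
          rw [← mul_assoc, hs₁ r]
          simp only [← mul_assoc, he₁]
      _ = e₁ * e₂ * r * (e₁ * e₂) := by rw [hs₂ (r * e₁)]; simp only [mul_assoc]
  · rw [map_mul, ← mul_assoc, hfe₂]
  · rw [mul_assoc, hlead g β (fun s => ?_) hβ]
    · exact hfix _ fun r => hα.mul_eq_zero hE hc hβ r (hg _)
    · rw [mul_assoc f]
      exact hg _

theorem idem_mul_eq_of_leading {E : SkewPBWExt R A n} {e : R} (f : A)
    (hfe : ∀ s h, f * s * (E.ι e * h) = 0)
    (hlead : ∀ g β, (∀ s, f * s * g = 0) → E.IsLeading g β → e * E.coeff g β = E.coeff g β)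
    (g : A) (hg : ∀ s, f * s * g = 0) : E.ι e * g = g := by
  induction hm : (E.coeff g).support.card using Nat.strong_induction_on generalizing g with
  | _ m ih =>
  by_cases hg0 : g = 0
  · rw [hg0, mul_zero]
  obtain ⟨β, hβ⟩ := E.exists_isLeading hg0
  set t := E.ι (E.coeff g β) * monom E.x β with ht
  have hte : E.ι e * t = t := by
    rw [ht, ← mul_assoc, ← map_mul, hlead g β hg hβ]
  have hsub : E.coeff (g - t) = (E.coeff g).erase β := by
    rw [map_sub, ht, coeff_term, sub_eq_iff_eq_add, Finsupp.erase_add_single]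
  have := ih (E.coeff (g - t)).support.card ?_ (g - t) (fun s => ?_) rfl
  · rwa [mul_sub, hte, sub_left_inj] at this
  · rw [← hm, hsub, Finsupp.support_erase]
    exact Finset.card_erase_lt_of_mem hβ.1
  · rw [mul_sub, hg, ← hte, hfe, sub_zero]

end SkewPBWExt

/-- If the extension is bijective and `R` is a right p.q.-Baer `(Σ,Δ)`-compatible
ring, then the skew PBW extension `A` is right p.q.-Baer. -/
theorem bijective_rightPQBaer_isRightPQBaer {R A : Type*} [Ring R] [Ring A] {n : ℕ} (E : SkewPBWExt R A n)
    (hbij : E.Bijective) (hpq : IsRightPQBaer R) (hcomp : E.SigmaDeltaCompatible) :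
    IsRightPQBaer A := by
  intro f
  obtain ⟨e, he, hs, hfe, hlead⟩ := SkewPBWExt.exists_idem_of_leading hbij hpq hcomp f
  have hfe' : ∀ s h, f * s * (E.ι e * h) = 0 := by
    intro s h
    rw [← mul_assoc, mul_assoc f, hcomp.semicentral he hs s, ← mul_assoc, ← mul_assoc, hfe,
      zero_mul, zero_mul, zero_mul]
  refine ⟨E.ι e, by rw [← map_mul, he], Set.ext fun g => ⟨fun hg => ⟨g, ?_⟩, ?_⟩⟩
  · exact SkewPBWExt.idem_mul_eq_of_leading f hfe' hlead g fun s => hg _ ⟨s, rfl⟩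
  · rintro ⟨h, rfl⟩ _ ⟨s, rfl⟩
    exact hfe' s h
end

section
/- Every Baer ring has Property (a.c.) on the right: if S is a ring such that for every nonempty subset X ⊆ S there is an idempotent e ∈ S with r_S(X) = eS, then for every finitely generated right ideal I of S there exists c ∈ S such that r_S(I) = r_S(cS). -/
/-- If the right annihilator of a right-multiplication-closed set is `eS` with `e` idempotent,
then it is also the right annihilator of the right ideal `(1 - e)S`. -/
theorem rAnn_eq_rAnn_rIdeal_one_sub {S : Type*} [Ring S] {X : Set S}
    (hX : ∀ x ∈ X, ∀ s : S, x * s ∈ X) {e : S} (he : e * e = e)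
    (h : rAnn X = rIdeal e) : rAnn X = rAnn (rIdeal (1 - e)) := by
  ext a
  constructor
  · rintro ha _ ⟨s, rfl⟩
    have hs : s * a ∈ rAnn X := fun x hx => by
      rw [← mul_assoc]
      exact ha _ (hX x hx s)
    rw [h] at hs
    obtain ⟨t, ht⟩ := hs
    have ht : e * t = s * a := ht
    change (1 - e) * s * a = 0
    rw [mul_assoc, ← ht, sub_mul, one_mul, ← mul_assoc, he, sub_self]
  · intro ha
    have h1 : (1 - e) * 1 * a = 0 := ha _ ⟨1, rfl⟩
    rw [mul_one, sub_mul, one_mul, sub_eq_zero] at h1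
    rw [h]
    exact ⟨a, h1.symm⟩

/-- Every Baer ring has Property (a.c.) on the right. -/
theorem IsBaerRing.hasRightAC {S : Type*} [Ring S] (h : IsBaerRing S) :
    HasRightAC S := by
  intro m a
  have hX : ∀ x ∈ {y : S | ∃ s : Fin m → S, y = ∑ i, a i * s i}, ∀ r : S,
      x * r ∈ {y : S | ∃ s : Fin m → S, y = ∑ i, a i * s i} := by
    rintro _ ⟨s, rfl⟩ r
    exact ⟨fun i => s i * r, by simp only [Finset.sum_mul, mul_assoc]⟩
  obtain ⟨e, he, heq⟩ := h {y : S | ∃ s : Fin m → S, y = ∑ i, a i * s i} ⟨_, fun _ => 0, rfl⟩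
  exact ⟨1 - e, rAnn_eq_rAnn_rIdeal_one_sub hX he heq⟩
end

section
/- Every right p.q.-Baer ring has Property (a.c.) on the right: if S is a ring such that for every a ∈ S there is an idempotent e ∈ S with r_S(aS) = eS, then for every finitely generated right ideal I of S there exists c ∈ S such that r_S(I) = r_S(cS). -/
/-- In a right p.q.-Baer ring, finitely many principal right ideals have a common right
annihilator generated by an idempotent. -/
theorem IsRightPQBaer.exists_idempotent {S : Type*} [Ring S] (h : IsRightPQBaer S) :
    ∀ (m : ℕ) (a : Fin m → S),
      ∃ g : S, g * g = g ∧ ∀ x, g * x = x ↔ ∀ i s, a i * s * x = 0 := by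
  intro m
  induction m with
  | zero => exact fun a => ⟨1, one_mul 1, fun x => by simp⟩
  | succ m ih =>
    intro a
    obtain ⟨e, he, hea⟩ := h (a 0)
    obtain ⟨g, hg, hga⟩ := ih fun i => a i.succ
    have hex (x : S) : e * x = x ↔ ∀ s, a 0 * s * x = 0 := by
      have h1 : x ∈ rAnn (rIdeal (a 0)) ↔ x ∈ rIdeal e := by rw [hea]
      have h2 : x ∈ rIdeal e ↔ e * x = x := by
        refine ⟨?_, fun hx => ⟨x, hx⟩⟩
        rintro ⟨y, rfl⟩
        simp only [← mul_assoc, he]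
      rw [← h2, ← h1]
      simp [rAnn, rIdeal]
    have hkey (x : S) : ∀ i s, a i * s * (e * g * x) = 0 := by
      refine Fin.forall_fin_succ.2 ⟨(hex _).1 ?_, fun i s => ?_⟩
      · simp only [← mul_assoc, he]
      · have := (hga (g * x)).1 (by rw [← mul_assoc, hg]) i (s * e)
        simpa only [mul_assoc] using this
    have hiff (x : S) : e * g * x = x ↔ ∀ i s, a i * s * x = 0 := by
      refine ⟨fun hx => hx ▸ hkey x, fun hx => ?_⟩
      rw [mul_assoc, (hga x).2 fun i => hx i.succ, (hex x).2 (hx 0)]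
    exact ⟨e * g, (hiff _).2 (by simpa using hkey 1), hiff⟩

/-- An element annihilates a finitely generated right ideal on the right iff it annihilates
the principal right ideals of the generators. -/
theorem mem_rAnn_span_iff {S : Type*} [Ring S] {m : ℕ} (a : Fin m → S) (x : S) :
    x ∈ rAnn {y : S | ∃ s : Fin m → S, y = ∑ i, a i * s i} ↔ ∀ i s, a i * s * x = 0 := by
  constructor
  · exact fun hx i s => hx _ ⟨Pi.single i s, by simp [Pi.single_apply]⟩
  · rintro hx _ ⟨s, rfl⟩
    rw [Finset.sum_mul]
    exact Finset.sum_eq_zero fun i _ => hx i (s i)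

/-- Every right p.q.-Baer ring has Property (a.c.) on the right. -/
theorem IsRightPQBaer.hasRightAC {S : Type*} [Ring S] (h : IsRightPQBaer S) :
    HasRightAC S := by
  intro m a
  obtain ⟨g, -, hga⟩ := h.exists_idempotent m a
  refine ⟨1 - g, Set.ext fun x => ?_⟩
  rw [mem_rAnn_span_iff]
  constructor
  · rintro hx _ ⟨s, rfl⟩
    have hsx : g * (s * x) = s * x :=
      (hga _).2 fun i t => by simpa only [mul_assoc] using hx i (t * s)
    simp only [mul_assoc, sub_mul, one_mul, hsx, sub_self]
  · intro hx
    have hx1 := hx (1 - g) ⟨1, mul_one _⟩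
    rw [sub_mul, one_mul, sub_eq_zero] at hx1
    exact (hga x).1 hx1.symm
end

section
/- Every Abelian right p.p.-ring has Property (a.c.) on the right: if S is a ring in which every idempotent is central and for every a ∈ S there is an idempotent e ∈ S with r_S(a) = eS, then for every finitely generated right ideal I of S there exists c ∈ S such that r_S(I) = r_S(cS). -/
/-- An element lies in the right ideal generated by an idempotent `e` iff `e` fixes it. -/
theorem mem_rIdeal_iff_of_idempotent {S : Type*} [Ring S] {e : S} (he : e * e = e) (b : S) :
    b ∈ rIdeal e ↔ e * b = b := by
  constructor
  · rintro ⟨t, rfl⟩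
    simp only [← mul_assoc, he]
  · exact fun h => ⟨b, h⟩

/-- In an Abelian ring, finitely many idempotents have a common refinement: an idempotent
fixing exactly the elements fixed by all of them. -/
theorem IsAbelianRing.exists_idempotent_forall_fixed {S : Type*} [Ring S]
    (hAb : IsAbelianRing S) {m : ℕ} (e : Fin m → S) (he : ∀ i, e i * e i = e i) :
    ∃ f : S, f * f = f ∧ ∀ b, f * b = b ↔ ∀ i, e i * b = b := by
  induction m with
  | zero => exact ⟨1, by simp, fun b => by simp⟩
  | succ m ih =>
    obtain ⟨f, hf, hfix⟩ := ih (fun i => e i.succ) fun i => he i.succ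
    have hcomm := hAb (e 0) (he 0)
    refine ⟨e 0 * f, ?_, fun b => ?_⟩
    · rw [mul_assoc, ← mul_assoc f, ← hcomm f, mul_assoc (e 0) f f, hf, ← mul_assoc, he]
    · rw [Fin.forall_fin_succ, ← hfix]
      constructor
      · intro h
        constructor
        · rw [← h, ← mul_assoc, ← mul_assoc, he]
        · rw [← h, hcomm, ← mul_assoc, ← mul_assoc, hf]
      · rintro ⟨h₀, h⟩
        rw [mul_assoc, h, h₀]

/-- In an Abelian ring, if the right annihilator of `x` is generated by an idempotent, then it
is also the right annihilator of the right ideal `xS`. -/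
theorem IsAbelianRing.rAnn_rIdeal {S : Type*} [Ring S] (hAb : IsAbelianRing S) {x e : S}
    (he : e * e = e) (hx : rAnn {x} = rIdeal e) : rAnn (rIdeal x) = rIdeal e := by
  ext b
  constructor
  · intro h
    rw [← hx]
    rintro _ rfl
    exact h _ ⟨1, mul_one _⟩
  · rintro ⟨t, rfl⟩ _ ⟨s, rfl⟩
    have hxe : x * e = 0 := (hx ▸ ⟨1, mul_one e⟩ : e ∈ rAnn {x}) x rfl
    simp only
    rw [mul_assoc, ← mul_assoc s, ← hAb e he s, mul_assoc e, ← mul_assoc, hxe, zero_mul]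

/-- The right annihilator of `1 - e` is generated by `e`. -/
theorem rAnn_one_sub_of_idempotent {S : Type*} [Ring S] {e : S} (he : e * e = e) :
    rAnn {1 - e} = rIdeal e := by
  ext b
  rw [mem_rIdeal_iff_of_idempotent he]
  simp [rAnn, sub_mul, sub_eq_zero, eq_comm]

/-- An element annihilates a finite sum of principal right ideals iff it annihilates each. -/
theorem mem_rAnn_sum_iff {S : Type*} [Ring S] {m : ℕ} (a : Fin m → S) (b : S) :
    b ∈ rAnn {y : S | ∃ s : Fin m → S, y = ∑ i, a i * s i} ↔ ∀ i, b ∈ rAnn (rIdeal (a i)) := by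
  constructor
  · rintro h i _ ⟨s, rfl⟩
    exact h _ ⟨Pi.single i s, by simp [Pi.single_apply]⟩
  · rintro h _ ⟨s, rfl⟩
    rw [Finset.sum_mul]
    exact Finset.sum_eq_zero fun i _ => h i _ ⟨s i, rfl⟩

/-- Every Abelian right p.p.-ring has Property (a.c.) on the right. -/
theorem abelian_rightPP_hasRightAC {S : Type*} [Ring S]
    (hAb : IsAbelianRing S) (hpp : IsRightPP S) :
    HasRightAC S := by
  intro m a
  choose e he hann using fun i => hpp (a i)
  obtain ⟨f, hf, hfix⟩ := hAb.exists_idempotent_forall_fixed e he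
  refine ⟨1 - f, ?_⟩
  ext b
  rw [mem_rAnn_sum_iff, hAb.rAnn_rIdeal hf (rAnn_one_sub_of_idempotent hf),
    mem_rIdeal_iff_of_idempotent hf, hfix]
  refine forall_congr' fun i => ?_
  rw [hAb.rAnn_rIdeal (he i) (hann i), mem_rIdeal_iff_of_idempotent (he i)]
end

section
/- Let R be a ring, Σ = {σ_1,…,σ_n} a family of ring endomorphisms of R, and Δ = {δ_1,…,δ_n} a family of maps with each δ_i a σ_i-derivation. If R is (Σ,Δ)-compatible, then for all a, b ∈ R with ab = 0 and all θ, β ∈ ℕ^n, both σ^θ(a)δ^β(b) = 0 and δ^β(a)σ^θ(b) = 0. -/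
theorem deltaPow_succ {R : Type*} {n : ℕ} (δ : Fin (n + 1) → R → R) (α : Fin (n + 1) → ℕ) (a : R) :
    deltaPow δ α a =
      (δ 0)^[α 0] (deltaPow (fun i => δ i.succ) (fun i => α i.succ) a) := by
  simp [deltaPow, List.ofFn_succ]

theorem deltaPow_zero_exponent {R : Type*} {n : ℕ} (δ : Fin n → R → R) (a : R) :
    deltaPow δ (fun _ => 0) a = a := by
  induction n with
  | zero => rfl
  | succ n ih => simp [deltaPow_succ, ih]

theorem deltaPow_single {R : Type*} {n : ℕ} (δ : Fin n → R → R) (i : Fin n) (a : R) :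
    deltaPow δ (Pi.single i 1) a = δ i a := by
  induction n with
  | zero => exact i.elim0
  | succ n ih =>
    rw [deltaPow_succ]
    induction i using Fin.cases with
    | zero => simp [deltaPow_zero_exponent]
    | succ j =>
      have h : (fun k : Fin n => (Pi.single j.succ 1 : Fin (n + 1) → ℕ) k.succ) = Pi.single j 1 := by
        ext k
        simp [Pi.single_apply]
      simp [h, ih]

theorem mapsTo_deltaPow {R : Type*} {n : ℕ} (δ : Fin n → R → R) {S : Set R}
    (hS : ∀ i, Set.MapsTo (δ i) S S) (α : Fin n → ℕ) : Set.MapsTo (deltaPow δ α) S S := by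
  induction n with
  | zero => exact Set.mapsTo_id S
  | succ n ih =>
    intro a ha
    rw [deltaPow_succ]
    exact (hS 0).iterate _ (ih _ (fun i => hS i.succ) _ ha)

theorem sigmaPow_eq_deltaPow {R : Type*} [Ring R] {n : ℕ} (σ : Fin n → R →+* R) (α : Fin n → ℕ) :
    sigmaPow σ α = deltaPow (fun i => ⇑(σ i)) α :=
  rfl

theorem sigmaPow_mul {R : Type*} [Ring R] {n : ℕ} (σ : Fin n → R →+* R) (α : Fin n → ℕ) (a b : R) :
    sigmaPow σ α (a * b) = sigmaPow σ α a * sigmaPow σ α b := by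
  simp only [sigmaPow_eq_deltaPow]
  induction n with
  | zero => rfl
  | succ n ih =>
    simp only [deltaPow_succ]
    rw [ih (fun i => σ i.succ), iterate_map_mul]

theorem sigmaPow_zero {R : Type*} [Ring R] {n : ℕ} (σ : Fin n → R →+* R) (α : Fin n → ℕ) :
    sigmaPow σ α 0 = 0 :=
  mapsTo_deltaPow _ (S := {0}) (fun i => by simp) α rfl

/-- In a `(Σ,Δ)`-compatible ring, `ab = 0` implies `σ^θ(a)δ^β(b) = 0` and
`δ^β(a)σ^θ(b) = 0`. -/
theorem compatible_sigma_delta_ann {R : Type*} [Ring R] {n : ℕ} (σ : Fin n → R →+* R) (δ : Fin n → R → R)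
    (hδadd : ∀ (i : Fin n) (a b : R), δ i (a + b) = δ i a + δ i b)
    (hδleib : ∀ (i : Fin n) (a b : R), δ i (a * b) = σ i a * δ i b + δ i a * b)
    (hcomp : ∀ (a b : R) (α : Fin n → ℕ),
      (a * b = 0 ↔ a * sigmaPow σ α b = 0) ∧ (a * b = 0 → a * deltaPow δ α b = 0)) :
    ∀ (a b : R), a * b = 0 → ∀ (θ β : Fin n → ℕ),
      sigmaPow σ θ a * deltaPow δ β b = 0 ∧ deltaPow δ β a * sigmaPow σ θ b = 0 := by
  have sigma_left (a b : R) (θ : Fin n → ℕ) (hab : a * b = 0) : sigmaPow σ θ a * b = 0 := by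
    rw [(hcomp _ _ θ).1, ← sigmaPow_mul, hab, sigmaPow_zero]
  have delta_left (a b : R) (i : Fin n) (hab : a * b = 0) : δ i a * b = 0 := by
    have hδ : a * δ i b = 0 := by
      simpa only [deltaPow_single] using (hcomp a b (Pi.single i 1)).2 hab
    have hσδ : σ i a * δ i b = 0 := by
      simpa only [sigmaPow_eq_deltaPow, deltaPow_single] using
        sigma_left a (δ i b) (Pi.single i 1) hδ
    have hzero : δ i 0 = 0 := by simpa using hδadd i 0 0
    simpa [hab, hσδ, hzero] using (hδleib i a b).symm
  intro a b hab θ β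
  exact ⟨sigma_left _ _ θ ((hcomp a b β).2 hab),
    ((hcomp _ b θ).1).1 (mapsTo_deltaPow δ (S := {c | c * b = 0})
      (fun i c hc => delta_left c b i hc) β hab)⟩
end

section
/- Let R be a reduced ring, Σ = {σ_1,…,σ_n} a family of ring endomorphisms of R, and Δ = {δ_1,…,δ_n} a family of maps with each δ_i a σ_i-derivation. Then R is Σ-rigid if and only if R is (Σ,Δ)-compatible. -/
section

variable {R : Type*}

theorem foldr_comp_id_of_forall {P : R → Prop} {l : List (R → R)}
    (h : ∀ f ∈ l, ∀ b, P b → P (f b)) {b : R} (hb : P b) : P (l.foldr (· ∘ ·) id b) := by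
  induction l with
  | nil => exact hb
  | cons f l ih =>
    exact h f List.mem_cons_self _ (ih fun g hg => h g (List.mem_cons_of_mem _ hg))

theorem foldr_comp_ofFn_eq_id {n : ℕ} {f : Fin n → R → R} (h : ∀ j, f j = id) :
    (List.ofFn f).foldr (· ∘ ·) id = id := by
  funext b
  refine foldr_comp_id_of_forall (P := fun x => x = b) (fun g hg x hx => ?_) rfl
  obtain ⟨j, rfl⟩ := (List.mem_ofFn' _ _).1 hg
  simpa [h j] using hx

theorem foldr_comp_ofFn_eq_apply {n : ℕ} {f : Fin n → R → R} (i : Fin n)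
    (h : ∀ j, j ≠ i → f j = id) : (List.ofFn f).foldr (· ∘ ·) id = f i := by
  induction n with
  | zero => exact i.elim0
  | succ n ih =>
    rw [List.ofFn_succ, List.foldr_cons]
    cases i using Fin.cases with
    | zero =>
      rw [foldr_comp_ofFn_eq_id fun j => h _ (Fin.succ_ne_zero j)]
      rfl
    | succ i =>
      rw [ih (f := fun j => f j.succ) i fun j hj => h _ (Fin.succ_injective _ |>.ne hj),
        h 0 (Fin.succ_ne_zero i).symm]
      rfl

theorem sigmaPow_single_one [Ring R] {n : ℕ} (σ : Fin n → R →+* R) (i : Fin n) :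
    sigmaPow σ (Pi.single i 1) = σ i := by
  unfold sigmaPow
  rw [foldr_comp_ofFn_eq_apply i fun j hj => by simp [Pi.single_eq_of_ne hj]]
  simp

theorem sigmaPow_of_forall [Ring R] {n : ℕ} {σ : Fin n → R →+* R} {P : R → Prop}
    (h : ∀ i b, P b → P (σ i b)) (α : Fin n → ℕ) {b : R} (hb : P b) : P (sigmaPow σ α b) := by
  refine foldr_comp_id_of_forall (fun f hf x hx => ?_) hb
  obtain ⟨i, rfl⟩ := (List.mem_ofFn' _ _).1 hf
  exact Function.Iterate.rec P hx (fun y hy => h i y hy) _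

theorem deltaPow_of_forall {n : ℕ} {δ : Fin n → R → R} {P : R → Prop}
    (h : ∀ i b, P b → P (δ i b)) (α : Fin n → ℕ) {b : R} (hb : P b) : P (deltaPow δ α b) := by
  refine foldr_comp_id_of_forall (fun f hf x hx => ?_) hb
  obtain ⟨i, rfl⟩ := (List.mem_ofFn' _ _).1 hf
  exact Function.Iterate.rec P hx (fun y hy => h i y hy) _

variable [Ring R] [IsReduced R] {a b : R}

theorem IsReduced.mul_eq_zero_symm (h : a * b = 0) : b * a = 0 := by
  refine eq_zero_of_pow_eq_zero (n := 2) ?_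
  rw [pow_two, mul_assoc, ← mul_assoc a, h, zero_mul, mul_zero]

theorem mul_map_eq_zero_iff_of_rigid {σ : R →+* R} (hσ : ∀ a, a * σ a = 0 → a = 0) :
    a * σ b = 0 ↔ a * b = 0 := by
  constructor <;> intro h
  · refine IsReduced.mul_eq_zero_symm (hσ _ ?_)
    rw [map_mul, mul_assoc, ← mul_assoc a, h, zero_mul, mul_zero]
  · refine hσ _ ?_
    rw [map_mul, mul_assoc, ← mul_assoc (σ b), ← map_mul, IsReduced.mul_eq_zero_symm h, map_zero,
      zero_mul, mul_zero]

theorem mul_derivation_eq_zero_of_rigid {σ : R →+* R} (hσ : ∀ a, a * σ a = 0 → a = 0)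
    {δ : R → R} (hadd : ∀ a b, δ (a + b) = δ a + δ b)
    (hleib : ∀ a b, δ (a * b) = σ a * δ b + δ a * b) (h : a * b = 0) : a * δ b = 0 := by
  have hδ : σ a * δ b + δ a * b = 0 := by
    rw [← hleib, h]
    simpa using hadd 0 0
  have hb : b * σ a = 0 := (mul_map_eq_zero_iff_of_rigid hσ).2 (IsReduced.mul_eq_zero_symm h)
  have hbab : b * (δ a * b) = 0 := by
    simpa [mul_add, ← mul_assoc, hb] using congrArg (b * ·) hδ
  have hab : δ a * b = 0 := by
    refine eq_zero_of_pow_eq_zero (n := 2) ?_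
    rw [pow_two, mul_assoc, hbab, mul_zero]
  rw [hab, add_zero] at hδ
  exact IsReduced.mul_eq_zero_symm <|
    (mul_map_eq_zero_iff_of_rigid hσ).1 (IsReduced.mul_eq_zero_symm hδ)

end

/-- For a reduced ring, `Σ`-rigidity is equivalent to `(Σ,Δ)`-compatibility. -/
theorem reduced_sigmaRigid_iff_compatible {R : Type*} [Ring R] {n : ℕ} (σ : Fin n → R →+* R) (δ : Fin n → R → R)
    (hδadd : ∀ (i : Fin n) (a b : R), δ i (a + b) = δ i a + δ i b)
    (hδleib : ∀ (i : Fin n) (a b : R), δ i (a * b) = σ i a * δ i b + δ i a * b)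
    (hred : IsReduced R) :
    (∀ (a : R) (α : Fin n → ℕ), a * sigmaPow σ α a = 0 → a = 0) ↔
      ∀ (a b : R) (α : Fin n → ℕ),
        (a * b = 0 ↔ a * sigmaPow σ α b = 0) ∧ (a * b = 0 → a * deltaPow δ α b = 0) := by
  constructor
  · intro h
    have hσ (i : Fin n) (a : R) (ha : a * σ i a = 0) : a = 0 :=
      h a (Pi.single i 1) (by rwa [sigmaPow_single_one])
    intro a b α
    refine ⟨(sigmaPow_of_forall (P := fun x => a * b = 0 ↔ a * x = 0) (fun i x hx => ?_) α
      Iff.rfl), fun hab => deltaPow_of_forall (P := fun x => a * x = 0) (fun i x hx => ?_) α hab⟩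
    · exact hx.trans (mul_map_eq_zero_iff_of_rigid (hσ i)).symm
    · exact mul_derivation_eq_zero_of_rigid (hσ i) (hδadd i) (hδleib i) hx
  · intro h a α ha
    exact eq_zero_of_pow_eq_zero (n := 2) ((pow_two a).trans ((h a a α).1.2 ha))
end
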